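/- Let m ≥ 2, let q ≥ 2 be an integer, let Ω be a nonempty closed subset of Σ_m, and let μ be a Borel probability measure supported on Ω. Let P_μ be the Borel probability measure on Σ_m with cylinder values P_μ[u] = ∏_{i ≤ |u|, q ∤ i} μ[u|J_i]. Then for P_μ-almost every x ∈ Σ_m, lim_{n→∞} (−log_m P_μ[x₁…x_n]) / n = s(Ω,μ). Consequently, the Hausdorff dimension of P_μ equals s(Ω,μ), and the Hausdorff dimension of Ξ_Ω is at least s(Ω,μ). -/

import Mathlib

open scoped Classical ENNReal
open Filter MeasureTheory Topology

noncomputable section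

/-- `Begins x u` : the finite word `u` is a prefix of the sequence `x` (indexed by `ℕ+`). -/
def Begins {m : ℕ} (x : ℕ+ → Fin m) (u : List (Fin m)) : Prop :=
  ∀ j : Fin u.length, x ⟨(j : ℕ) + 1, Nat.succ_pos _⟩ = u.get j

/-- `Cyl u` : the cylinder set of the word `u`. -/
def Cyl {m : ℕ} (u : List (Fin m)) : Set (ℕ+ → Fin m) := {x | Begins x u}

/-- `Pref Ω` : the set of (finite) prefixes of sequences in `Ω`. -/
def Pref {m : ℕ} (Ω : Set (ℕ+ → Fin m)) : Set (List (Fin m)) := {u | ∃ x ∈ Ω, Begins x u}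

/-- number of length-`n` words beginning some sequence of `X`. -/
def NWords {m : ℕ} (n : ℕ) (X : Set (ℕ+ → Fin m)) : ℕ :=
  Set.ncard {u : List (Fin m) | u.length = n ∧ u ∈ Pref X}

/-- restriction of `x` to the geometric progression `J_i = {i, qi, q²i, …}`:
`(x|J_i)_k = x_{q^{k-1} i}` for `k ≥ 1`. -/
def RestrJ {m : ℕ} (q : ℕ+) (x : ℕ+ → Fin m) (i : ℕ+) : ℕ+ → Fin m :=
  fun k => x (q ^ ((k : ℕ) - 1) * i)

/-- the multiplicative subshift `X_Ω = {x : x|J_i ∈ Ω for all i with q ∤ i}`. -/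
def XOm {m : ℕ} (q : ℕ+) (Ω : Set (ℕ+ → Fin m)) : Set (ℕ+ → Fin m) :=
  {x | ∀ i : ℕ+, ¬ q ∣ i → RestrJ q x i ∈ Ω}

/-- the real number `Σ_{k≥1} x_k m^{-k}` with base-`m` digit sequence `x`. -/
def ValMap (m : ℕ) (x : ℕ+ → Fin m) : ℝ := ∑' k : ℕ+, ((x k : ℕ) : ℝ) * (m : ℝ)⁻¹ ^ (k : ℕ)

/-- the subset of `[0,1]` of reals whose base-`m` digit sequence lies in `X`. -/
def XiSet {m : ℕ} (X : Set (ℕ+ → Fin m)) : Set ℝ := {r | ∃ x ∈ X, r = ValMap m x}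

/-- entropy (base-`m` logarithms) of the partition of `Ω` into `k`-cylinders, for a measure
supported on `Ω` (words that are not prefixes of `Ω` get measure `0` and contribute nothing). -/
def Hent (m : ℕ) (μ : Measure (ℕ+ → Fin m)) (k : ℕ) : ℝ :=
  -∑ u : Fin k → Fin m,
    ((μ (Cyl (List.ofFn u))).toReal * Real.logb m (μ (Cyl (List.ofFn u))).toReal)

/-- `s(Ω,μ) = (q-1)² Σ_{k≥1} H_m^μ(α_k)/q^{k+1}`. -/
def sOm (m : ℕ) (q : ℕ+) (μ : Measure (ℕ+ → Fin m)) : ℝ :=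
  ((q : ℝ) - 1) ^ 2 * ∑' k : ℕ, Hent m μ (k + 1) / (q : ℝ) ^ (k + 2)

/-- cylinder determined by the first `n` entries of `x`, i.e. `[x₁…x_n]`. -/
def CylN {m : ℕ} (n : ℕ) (x : ℕ+ → Fin m) : Set (ℕ+ → Fin m) :=
  {y | ∀ k : ℕ+, (k : ℕ) ≤ n → y k = x k}

/-- the cylinder `[u|J_i]` where `u = x₁…x_n`: sequences `y` with
`y_{ℓ+1} = x_{q^ℓ i}` for all `ℓ ≥ 0` with `q^ℓ i ≤ n`. -/
def CylJ {m : ℕ} (q n i : ℕ+) (x : ℕ+ → Fin m) : Set (ℕ+ → Fin m) :=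
  {y | ∀ ℓ : ℕ, q ^ ℓ * i ≤ n → y ⟨ℓ + 1, Nat.succ_pos _⟩ = x (q ^ ℓ * i)}

/-- `P` has the product structure `P[u] = ∏_{i ≤ |u|, q ∤ i} μ[u|J_i]` on cylinders. -/
def ProdProp {m : ℕ} (q : ℕ+) (μ P : Measure (ℕ+ → Fin m)) : Prop :=
  ∀ (n : ℕ+) (x : ℕ+ → Fin m),
    P (CylN (n : ℕ) x) = ∏ i ∈ (Finset.Icc 1 n).filter (fun i => ¬ q ∣ i), μ (CylJ q n i x)

/-- `t` is a `[1, m^{1/(q-1)}]`-valued solution of `t(u)^q = Σ_{j : uj ∈ Pref(Ω)} t(uj)`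
on the tree of prefixes of `Ω`. -/
def TSol {m : ℕ} (q : ℕ+) (Ω : Set (ℕ+ → Fin m)) (t : List (Fin m) → ℝ) : Prop :=
  ∀ u ∈ Pref Ω,
    t u ∈ Set.Icc 1 ((m : ℝ) ^ ((1 : ℝ) / ((q : ℝ) - 1))) ∧
    t u ^ (q : ℕ) =
      ∑ j ∈ Finset.univ.filter (fun j : Fin m => u ++ [j] ∈ Pref Ω), t (u ++ [j])

/-- `μ` has the cylinder values `μ[u₁…u_k] = ∏_{j=1}^k t(u₁…u_j)/t(u₁…u_{j-1})^q`
for prefixes `u` of `Ω`. -/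
def CylVals {m : ℕ} (q : ℕ+) (Ω : Set (ℕ+ → Fin m)) (t : List (Fin m) → ℝ)
    (μ : Measure (ℕ+ → Fin m)) : Prop :=
  ∀ u ∈ Pref Ω,
    μ (Cyl u) =
      ENNReal.ofReal (∏ j ∈ Finset.range u.length, t (u.take (j + 1)) / t (u.take j) ^ (q : ℕ))

section PartA

lemma card_notdvd (q N : ℕ) :
    ((Finset.Ioc 0 N).filter (fun i => ¬ q ∣ i)).card + N / q = N := by
  have h := Finset.card_filter_add_card_filter_not (s := Finset.Ioc 0 N) (fun i => q ∣ i)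
  rw [Nat.Ioc_filter_dvd_card_eq_div] at h
  simp at h
  omega

/-- number of `i ≤ n` not divisible by `q` with `⌊log_q (n / i)⌋ = k`. -/
def cnt (q n k : ℕ) : ℕ :=
  (((Finset.Ioc 0 n).filter (fun i => ¬ q ∣ i)).filter (fun i => Nat.log q (n / i) = k)).card

lemma cnt_add (q : ℕ) (hq : 2 ≤ q) (n k : ℕ) :
    cnt q n k + ((Finset.Ioc 0 (n / q ^ (k + 1))).filter (fun i => ¬ q ∣ i)).card =
      ((Finset.Ioc 0 (n / q ^ k)).filter (fun i => ¬ q ∣ i)).card := by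
  unfold cnt
  rw [← Finset.card_union_of_disjoint]
  · congr 1
    ext i
    have hk : 0 < q ^ k := by positivity
    have hk1 : 0 < q ^ (k + 1) := by positivity
    simp only [Finset.mem_union, Finset.mem_filter, Finset.mem_Ioc]
    by_cases hi : 0 < i
    swap
    · simp [hi]
    have hle : n / q ^ (k + 1) ≤ n / q ^ k :=
      Nat.div_le_div_left (Nat.pow_le_pow_right (by omega) (by omega)) hk
    have hle' : n / q ^ k ≤ n := Nat.div_le_self _ _
    have key : i ≤ n → (Nat.log q (n / i) = k ↔ i ≤ n / q ^ k ∧ ¬ i ≤ n / q ^ (k + 1)) := by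
      intro hin
      have h0 : n / i ≠ 0 := (Nat.div_pos hin hi).ne'
      rw [Nat.log_eq_iff (Or.inr ⟨by omega, h0⟩), Nat.le_div_iff_mul_le hi, Nat.div_lt_iff_lt_mul hi,
        Nat.le_div_iff_mul_le hk, Nat.le_div_iff_mul_le hk1, not_le, mul_comm i (q ^ k), mul_comm i (q ^ (k + 1))]
    by_cases hin : i ≤ n
    · rw [key hin]
      constructor
      · rintro (h | h)
        · exact ⟨⟨hi, h.2.1⟩, h.1.2⟩
        · exact ⟨⟨hi, by omega⟩, h.2⟩
      · rintro ⟨⟨_, h1⟩, h2⟩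
        by_cases h3 : i ≤ n / q ^ (k + 1)
        · exact Or.inr ⟨⟨hi, h3⟩, h2⟩
        · exact Or.inl ⟨⟨⟨hi, hin⟩, h2⟩, h1, h3⟩
    · constructor
      · rintro (h | h)
        · exact absurd h.1.1.2 hin
        · exact absurd (h.1.2.trans (hle.trans hle')) hin
      · rintro ⟨⟨_, h1⟩, h2⟩
        exact absurd (h1.trans hle') hin
  · rw [Finset.disjoint_left]
    intro i h1 h2
    simp only [Finset.mem_filter, Finset.mem_Ioc] at h1 h2
    obtain ⟨⟨⟨hi, hin⟩, _⟩, h⟩ := h1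
    have h0 : n / i ≠ 0 := (Nat.div_pos hin hi).ne'
    rw [Nat.log_eq_iff (Or.inr ⟨by omega, h0⟩), Nat.div_lt_iff_lt_mul hi] at h
    have := (Nat.le_div_iff_mul_le (by positivity)).1 h2.1.2
    rw [mul_comm] at this
    omega

lemma cnt_eq (q : ℕ) (hq : 2 ≤ q) (n k : ℕ) :
    cnt q n k + 2 * (n / q ^ (k + 1)) = n / q ^ k + n / q ^ (k + 2) := by
  have h1 := cnt_add q hq n k
  have h2 := card_notdvd q (n / q ^ k)
  have h3 := card_notdvd q (n / q ^ (k + 1))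
  rw [Nat.div_div_eq_div_mul, ← pow_succ] at h2 h3
  have : k + 1 + 1 = k + 2 := rfl
  rw [this] at h3
  omega

lemma cnt_le (q : ℕ) (hq : 2 ≤ q) (n k : ℕ) : cnt q n k ≤ n / q ^ k := by
  have h1 := cnt_add q hq n k
  have h2 := card_notdvd q (n / q ^ k)
  exact (Nat.le_add_right _ _).trans (h1.le.trans ((Nat.le_add_right _ _).trans h2.le))

lemma tendsto_div_nat (d : ℕ) :
    Tendsto (fun n : ℕ => ((n / d : ℕ) : ℝ) / n) atTop (𝓝 (1 / (d : ℝ))) := by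
  have h := (tendsto_nat_floor_mul_div_atTop (R := ℝ) (a := 1 / (d : ℝ)) (by positivity)).comp
    tendsto_natCast_atTop_atTop
  refine h.congr fun n => ?_
  simp only [Function.comp]
  congr 2
  rw [one_div_mul_eq_div, Nat.floor_div_eq_div]

lemma cnt_tendsto (q : ℕ) (hq : 2 ≤ q) (k : ℕ) :
    Tendsto (fun n : ℕ => (cnt q n k : ℝ) / n) atTop (𝓝 (((q : ℝ) - 1) ^ 2 / (q : ℝ) ^ (k + 2))) := by
  have h := ((tendsto_div_nat (q ^ k)).add (tendsto_div_nat (q ^ (k + 2)))).sub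
    ((tendsto_div_nat (q ^ (k + 1))).const_mul 2)
  have hq0 : (q : ℝ) ≠ 0 := by positivity
  convert h using 1
  · ext n
    have := cnt_eq q hq n k
    have h' : (cnt q n k : ℝ) = (n / q ^ k : ℕ) + (n / q ^ (k + 2) : ℕ) - 2 * (n / q ^ (k + 1) : ℕ) := by
      rw [eq_sub_iff_add_eq]; exact_mod_cast this
    rw [h']; ring
  · congr 1
    push_cast
    field_simp
    ring

lemma sum_cnt (q : ℕ) (n : ℕ) (a : ℕ → ℝ) :
    ∑ i ∈ (Finset.Ioc 0 n).filter (fun i => ¬ q ∣ i), a (Nat.log q (n / i) + 1) =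
      ∑' k, a (k + 1) * cnt q n k := by
  rw [tsum_eq_sum (s := Finset.range (n + 1))]
  · rw [← Finset.sum_fiberwise_of_maps_to (t := Finset.range (n + 1))
      (g := fun i => Nat.log q (n / i))]
    · refine Finset.sum_congr rfl fun k _ => ?_
      rw [Finset.sum_congr rfl (g := fun _ => a (k + 1))]
      · rw [Finset.sum_const, nsmul_eq_mul, mul_comm, cnt]
      · intro i hi
        rw [(Finset.mem_filter.1 hi).2]
    · intro i _
      rw [Finset.mem_range]
      exact Nat.lt_succ_of_le ((Nat.log_le_self _ _).trans (Nat.div_le_self _ _))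
  · intro k hk
    have : cnt q n k = 0 := by
      rw [cnt, Finset.card_eq_zero, Finset.filter_eq_empty_iff]
      intro i _ h
      have : Nat.log q (n / i) ≤ n := (Nat.log_le_self _ _).trans (Nat.div_le_self _ _)
      rw [Finset.mem_range] at hk
      omega
    simp [this]

lemma det_limit (q : ℕ) (hq : 2 ≤ q) (a : ℕ → ℝ) (C : ℝ) (ha : ∀ k, |a (k + 1)| ≤ C * ((k : ℝ) + 1) ^ 2) :
    Tendsto (fun n : ℕ => (∑ i ∈ (Finset.Ioc 0 n).filter (fun i => ¬ q ∣ i),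
      a (Nat.log q (n / i) + 1)) / n) atTop
      (𝓝 (((q : ℝ) - 1) ^ 2 * ∑' k : ℕ, a (k + 1) / (q : ℝ) ^ (k + 2))) := by
  have hq0 : (0 : ℝ) < q := by positivity
  have hq1 : (1 : ℝ) / q < 1 := by
    rw [div_lt_one hq0]; exact_mod_cast (by omega : 1 < q)
  have hsum : Summable (fun k : ℕ => C * ((k : ℝ) + 1) ^ 2 * (1 / (q : ℝ)) ^ k) := by
    have h := fun j => summable_pow_mul_geometric_of_norm_lt_one (R := ℝ) j (r := 1 / (q : ℝ))
      (by rw [Real.norm_of_nonneg (by positivity)]; exact hq1)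
    refine (((h 2).add (((h 1).mul_left 2).add (h 0))).mul_left C).congr fun k => ?_
    ring
  have := tendsto_tsum_of_dominated_convergence (𝓕 := atTop)
    (f := fun (n : ℕ) k => a (k + 1) * (cnt q n k / n)) hsum
    (fun k => (cnt_tendsto q hq k).const_mul (a (k + 1))) (by
      filter_upwards [eventually_gt_atTop 0] with n hn k
      rw [norm_mul, Real.norm_eq_abs, Real.norm_of_nonneg (by positivity)]
      refine mul_le_mul (ha k) ?_ (by positivity) ((abs_nonneg _).trans (ha k))
      rw [div_le_iff₀ (by exact_mod_cast hn)]
      calc (cnt q n k : ℝ) ≤ ((n / q ^ k : ℕ) : ℝ) := by exact_mod_cast cnt_le q hq n k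
        _ ≤ (n : ℝ) / ((q ^ k : ℕ) : ℝ) := Nat.cast_div_le
        _ = _ := by push_cast; rw [one_div, inv_pow]; ring)
  convert this using 1
  · ext n
    rw [sum_cnt, ← tsum_div_const]
    congr 1; ext k; ring
  · congr 1
    rw [← tsum_mul_left]
    congr 1; ext k; ring

end PartA

section PartB

variable {m : ℕ}

/-- the first `n` entries of `x`. -/
def pre (n : ℕ) (x : ℕ+ → Fin m) : Fin n → Fin m := fun j => x ⟨(j : ℕ) + 1, Nat.succ_pos _⟩

lemma measurable_pre (n : ℕ) : Measurable (pre (m := m) n) := by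
  unfold pre; fun_prop

lemma cylN_eq (n : ℕ) (x : ℕ+ → Fin m) : CylN n x = pre n ⁻¹' {pre n x} := by
  ext y
  simp only [CylN, Set.mem_ofPred_eq, Set.mem_preimage, Set.mem_singleton_iff]
  constructor
  · intro h
    ext1 j
    exact h _ j.2
  · intro h k hk
    have hk0 := k.pos
    have := congrFun h ⟨(k : ℕ) - 1, by omega⟩
    simp only [pre] at this
    have hk' : (⟨(k : ℕ) - 1 + 1, Nat.succ_pos _⟩ : ℕ+) = k := by
      apply PNat.eq; simp; omega
    rwa [hk'] at this

lemma cyl_ofFn (n : ℕ) (u : Fin n → Fin m) : Cyl (List.ofFn u) = pre n ⁻¹' {u} := by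
  ext y
  simp only [Cyl, Begins, Set.mem_ofPred_eq, Set.mem_preimage, Set.mem_singleton_iff]
  constructor
  · intro h
    ext1 j
    have := h (Fin.cast (by simp) j)
    simpa [pre] using this
  · rintro rfl j
    simp [pre]

lemma measurableSet_cylN (n : ℕ) (x : ℕ+ → Fin m) : MeasurableSet (CylN n x) := by
  rw [cylN_eq]; exact measurable_pre n (MeasurableSet.singleton _)

lemma cylN_anti (x : ℕ+ → Fin m) : Antitone (fun n => CylN n x) := by
  intro a b hab y hy k hk
  exact hy k (hk.trans hab)

/-- integer formed by the first `n` digits. -/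
def Jn (x : ℕ+ → Fin m) : ℕ → ℕ
  | 0 => 0
  | n + 1 => m * Jn x n + (x n.succPNat : ℕ)

/-- tail value. -/
def Tn (x : ℕ+ → Fin m) (n : ℕ) : ℝ := ∑' k : ℕ, ((x (n + k).succPNat : ℕ) : ℝ) * (m : ℝ)⁻¹ ^ (k + 1)

lemma hasSum_geo (hm : 2 ≤ m) :
    HasSum (fun k : ℕ => ((m : ℝ) - 1) * (m : ℝ)⁻¹ ^ (k + 1)) 1 := by
  have hm0 : (0 : ℝ) < m := by positivity
  have hm1 : (1 : ℝ) < m := by exact_mod_cast (by omega : 1 < m)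
  have h := (hasSum_geometric_of_lt_one (r := (m : ℝ)⁻¹) (by positivity)
    (inv_lt_one_of_one_lt₀ hm1)).mul_left (((m : ℝ) - 1) * (m : ℝ)⁻¹)
  have e1 : ((m : ℝ) - 1) * (m : ℝ)⁻¹ * (1 - (m : ℝ)⁻¹)⁻¹ = 1 := by
    have : (m : ℝ) - 1 ≠ 0 := by linarith
    field_simp
  have e2 : (fun k : ℕ => ((m : ℝ) - 1) * (m : ℝ)⁻¹ ^ (k + 1)) =
      fun k : ℕ => ((m : ℝ) - 1) * (m : ℝ)⁻¹ * (m : ℝ)⁻¹ ^ k := by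
    funext k; rw [pow_succ]; ring
  rw [e1] at h
  rw [e2]
  exact h

lemma digit_le (hm : 2 ≤ m) (d : Fin m) : ((d : ℕ) : ℝ) ≤ (m : ℝ) - 1 := by
  have := d.2
  rw [le_sub_iff_add_le]; exact_mod_cast this

lemma summable_T (hm : 2 ≤ m) (x : ℕ+ → Fin m) (n : ℕ) :
    Summable (fun k : ℕ => ((x (n + k).succPNat : ℕ) : ℝ) * (m : ℝ)⁻¹ ^ (k + 1)) :=
  Summable.of_nonneg_of_le (fun k => by positivity)
    (fun k => mul_le_mul_of_nonneg_right (digit_le hm _) (by positivity)) (hasSum_geo hm).summable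

lemma Tn_nonneg (x : ℕ+ → Fin m) (n : ℕ) : 0 ≤ Tn x n := tsum_nonneg fun k => by positivity

lemma Tn_le (hm : 2 ≤ m) (x : ℕ+ → Fin m) (n : ℕ) : Tn x n ≤ 1 := by
  rw [← (hasSum_geo hm).tsum_eq]
  exact (summable_T hm x n).tsum_le_tsum
    (fun k => mul_le_mul_of_nonneg_right (digit_le hm _) (by positivity)) (hasSum_geo hm).summable

lemma Tn_succ (hm : 2 ≤ m) (x : ℕ+ → Fin m) (n : ℕ) :
    (m : ℝ) * Tn x n = (x n.succPNat : ℕ) + Tn x (n + 1) := by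
  have hm0 : (m : ℝ) ≠ 0 := by positivity
  rw [Tn, (summable_T hm x n).tsum_eq_zero_add, mul_add, ← tsum_mul_left, Tn]
  congr 1
  · simp; field_simp
  · congr 1; ext k
    rw [show n + (k + 1) = n + 1 + k by ring, pow_succ _ (k + 1)]
    field_simp

lemma val_eq (hm : 2 ≤ m) (x : ℕ+ → Fin m) (n : ℕ) :
    (m : ℝ) ^ n * ValMap m x = Jn x n + Tn x n := by
  induction n with
  | zero =>
    have := tsum_pnat_eq_tsum_succ (f := fun k : ℕ => if h : 0 < k then
      ((x ⟨k, h⟩ : ℕ) : ℝ) * (m : ℝ)⁻¹ ^ k else 0)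
    simp only [Jn, ValMap, Tn]
    simp only [PNat.pos, dite_true, Nat.succ_pos] at this
    simp only [pow_zero, one_mul, Nat.cast_zero, zero_add]
    exact this
  | succ n ih =>
    rw [pow_succ, mul_right_comm, ih, Jn, add_mul, mul_comm (Tn x n), Tn_succ hm]
    push_cast; ring

lemma Jn_inj (x y : ℕ+ → Fin m) (n : ℕ) : Jn x n = Jn y n ↔ x ∈ CylN n y := by
  induction n with
  | zero =>
    simp only [Jn, CylN, Set.mem_ofPred_eq, true_iff]
    intro k hk
    exact absurd hk (by simp)
  | succ n ih =>
    have hs : x ∈ CylN (n + 1) y ↔ x ∈ CylN n y ∧ x n.succPNat = y n.succPNat := by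
      simp only [CylN, Set.mem_ofPred_eq]
      constructor
      · intro h
        exact ⟨fun k hk => h k (by omega), h _ (by simp)⟩
      · rintro ⟨h1, h2⟩ k hk
        rcases Nat.lt_or_ge n k with h | h
        · have : k = n.succPNat := by apply PNat.eq; simp; omega
          rw [this, h2]
        · exact h1 k h
    rw [hs, ← ih, Jn, Jn]
    have hx := (x n.succPNat).2
    have hy := (y n.succPNat).2
    constructor
    · intro h
      have h1 := congrArg (· % m) h
      simp only [Nat.mul_add_mod, Nat.mod_eq_of_lt hx, Nat.mod_eq_of_lt hy] at h1
      refine ⟨?_, Fin.ext h1⟩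
      rw [h1] at h
      exact Nat.eq_of_mul_eq_mul_left (by omega) (Nat.add_right_cancel h)
    · rintro ⟨h1, h2⟩
      rw [h1, h2]

lemma measurable_val : Measurable (ValMap m) := by
  unfold ValMap
  refine Measurable.tsum fun k => ?_
  refine Measurable.mul_const ?_ _
  exact (measurable_of_countable (fun d : Fin m => ((d : ℕ) : ℝ))).comp (measurable_pi_apply k)

/-- `m^{-n}` as an extended nonnegative real. -/
def rn (m n : ℕ) : ℝ≥0∞ := ENNReal.ofReal (((m : ℝ) ^ n)⁻¹)

lemma rn_pos (hm : 2 ≤ m) (n : ℕ) : 0 < rn m n := by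
  rw [rn, ENNReal.ofReal_pos]; positivity

lemma rn_tendsto (hm : 2 ≤ m) : Tendsto (rn m) atTop (𝓝 0) := by
  rw [← ENNReal.ofReal_zero]
  refine ENNReal.tendsto_ofReal ?_
  have hm1 : (1 : ℝ) < m := by exact_mod_cast (by omega : 1 < m)
  exact (tendsto_pow_atTop_atTop_of_one_lt hm1).inv_tendsto_atTop

lemma rn_succ (hm : 2 ≤ m) (n : ℕ) : rn m n = m * rn m (n + 1) := by
  have hm0 : (m : ℝ) ≠ 0 := by positivity
  rw [rn, rn, ← ENNReal.ofReal_natCast, ← ENNReal.ofReal_mul (by positivity)]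
  congr 1
  rw [pow_succ]; field_simp

lemma rn_anti (hm : 2 ≤ m) : Antitone (rn m) := by
  have hm1 : (1 : ℝ) ≤ m := by exact_mod_cast (by omega : 1 ≤ m)
  intro a b hab
  exact ENNReal.ofReal_le_ofReal (inv_anti₀ (by positivity) (pow_le_pow_right₀ hm1 hab))

lemma ediam_image (hm : 2 ≤ m) (n : ℕ) (A : Set (ℕ+ → Fin m))
    (hA : ∀ x ∈ A, ∀ y ∈ A, x ∈ CylN n y) : Metric.ediam (ValMap m '' A) ≤ rn m n := by
  apply Metric.ediam_le
  rintro _ ⟨x, hx, rfl⟩ _ ⟨y, hy, rfl⟩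
  rw [edist_dist, rn]
  apply ENNReal.ofReal_le_ofReal
  have h := (Jn_inj x y n).2 (hA x hx y hy)
  have hm0 : (0 : ℝ) < (m : ℝ) ^ n := by positivity
  rw [← one_div, le_div_iff₀ hm0, Real.dist_eq, ← abs_of_pos hm0, ← abs_mul, mul_comm,
    mul_sub, val_eq hm, val_eq hm, h, abs_le]
  constructor <;> linarith [Tn_nonneg x n, Tn_nonneg y n, Tn_le hm x n, Tn_le hm y n]

lemma upper_dim (hm : 2 ≤ m) (P : Measure (ℕ+ → Fin m)) [IsProbabilityMeasure P] (t : NNReal)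
    (ht : 0 < t) (h : ∀ᵐ x ∂P, ∀ᶠ n in atTop, rn m n ^ (t : ℝ) ≤ P (CylN n x)) :
    ∃ F : Set ℝ, MeasurableSet F ∧ Measure.map (ValMap m) P F = 1 ∧ dimH F ≤ t := by
  let E : ℕ → Set (ℕ+ → Fin m) := fun N => {x | ∀ n ≥ N, rn m n ^ (t : ℝ) ≤ P (CylN n x)}
  have hE : ∀ N, Measure.hausdorffMeasure (t : ℝ) (ValMap m '' E N) ≤ 1 := by
    intro N
    refine (Measure.hausdorffMeasure_le_liminf_sum (ι := fun n => Fin n → Fin m) (t : ℝ)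
      (ValMap m '' E N) (rn m) (rn_tendsto hm)
      (fun n w => ValMap m '' (E N ∩ pre n ⁻¹' {w})) ?_ ?_).trans ?_
    · refine Eventually.of_forall fun n w => ediam_image hm n _ ?_
      rintro x ⟨_, hx⟩ y ⟨_, hy⟩
      rw [cylN_eq, Set.mem_preimage, Set.mem_singleton_iff, hx, hy]
    · refine Eventually.of_forall fun n => ?_
      rintro _ ⟨x, hx, rfl⟩
      exact Set.mem_iUnion.2 ⟨pre n x, x, ⟨hx, rfl⟩, rfl⟩
    · refine Filter.liminf_le_of_le (by isBoundedDefault) fun b hb => ?_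
      obtain ⟨n, hn, hnN⟩ := (hb.and (eventually_ge_atTop N)).exists
      refine hn.trans ?_
      calc ∑ w : Fin n → Fin m, Metric.ediam (ValMap m '' (E N ∩ pre n ⁻¹' {w})) ^ (t : ℝ)
          ≤ ∑ w : Fin n → Fin m, P (pre n ⁻¹' {w}) := by
            refine Finset.sum_le_sum fun w _ => ?_
            rcases (E N ∩ pre n ⁻¹' {w}).eq_empty_or_nonempty with h0 | ⟨x, hx, hxw⟩
            · rw [h0, Set.image_empty, Metric.ediam_empty, ENNReal.zero_rpow_of_pos (by exact_mod_cast ht)]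
              exact bot_le
            · have h1 := hx n hnN
              rw [cylN_eq, show pre n x = w from hxw] at h1
              refine le_trans (ENNReal.rpow_le_rpow (ediam_image hm n _ ?_) (by positivity)) h1
              rintro x ⟨_, hx⟩ y ⟨_, hy⟩
              rw [cylN_eq, Set.mem_preimage, Set.mem_singleton_iff, hx, hy]
        _ = P (pre n ⁻¹' ((Finset.univ : Finset (Fin n → Fin m)) : Set (Fin n → Fin m))) :=
            sum_measure_preimage_singleton _ fun w _ => measurable_pre n (MeasurableSet.singleton _)
        _ ≤ 1 := prob_le_one
  refine ⟨⋃ N, toMeasurable (Measure.hausdorffMeasure (t : ℝ)) (ValMap m '' E N),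
    MeasurableSet.iUnion fun N => measurableSet_toMeasurable _ _, ?_, ?_⟩
  · rw [Measure.map_apply measurable_val (MeasurableSet.iUnion fun N => measurableSet_toMeasurable _ _)]
    rw [← mem_ae_iff_prob_eq_one (measurable_val (MeasurableSet.iUnion fun N => measurableSet_toMeasurable _ _))]
    filter_upwards [h] with x hx
    obtain ⟨N, hN⟩ := eventually_atTop.1 hx
    exact Set.mem_iUnion.2 ⟨N, subset_toMeasurable _ _ ⟨x, hN, rfl⟩⟩
  · rw [dimH_iUnion]
    refine iSup_le fun N => dimH_le_of_hausdorffMeasure_ne_top ?_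
    rw [measure_toMeasurable]
    exact ((hE N).trans_lt ENNReal.one_lt_top).ne

lemma lower_aux (hm : 2 ≤ m) (P : Measure (ℕ+ → Fin m)) [IsProbabilityMeasure P] (c : ℝ≥0∞)
    (n : ℕ) (E : Set (ℕ+ → Fin m)) (hE : ∀ x ∈ E, P (CylN n x) ≤ c) (s : Set ℝ)
    (hs : Metric.ediam s ≤ rn m n) : P (ValMap m ⁻¹' s ∩ E) ≤ 4 * c := by
  rcases s.eq_empty_or_nonempty with rfl | ⟨v, hv⟩
  · simp
  have hm0 : (0 : ℝ) < (m : ℝ) ^ n := by positivity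
  let I : Finset ℤ := Finset.Icc ⌈(m : ℝ) ^ n * v - 2⌉ ⌊(m : ℝ) ^ n * v + 1⌋
  have hI : I.card ≤ 4 := by
    have h1 := Int.le_ceil ((m : ℝ) ^ n * v - 2)
    have h2 := Int.floor_le ((m : ℝ) ^ n * v + 1)
    have h3 : (⌊(m : ℝ) ^ n * v + 1⌋ : ℝ) ≤ ⌈(m : ℝ) ^ n * v - 2⌉ + 3 := by linarith
    have h4 : ⌊(m : ℝ) ^ n * v + 1⌋ ≤ ⌈(m : ℝ) ^ n * v - 2⌉ + 3 := by exact_mod_cast h3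
    simp only [I, Int.card_Icc]
    omega
  have hsub : ValMap m ⁻¹' s ∩ E ⊆ ⋃ j ∈ I, {x | x ∈ E ∧ (Jn x n : ℤ) = j} := by
    rintro x ⟨hx, hxE⟩
    simp only [Set.mem_iUnion]
    refine ⟨(Jn x n : ℤ), ?_, hxE, rfl⟩
    have h1 : edist (ValMap m x) v ≤ rn m n := (Metric.edist_le_ediam_of_mem (show ValMap m x ∈ s from hx) hv).trans hs
    rw [edist_dist, rn, ENNReal.ofReal_le_ofReal_iff (by positivity), ← one_div, le_div_iff₀ hm0,
      Real.dist_eq, ← abs_of_pos hm0, ← abs_mul, mul_comm, mul_sub, val_eq hm,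
      abs_le] at h1
    have h2 := Tn_nonneg x n
    have h3 := Tn_le hm x n
    rw [Finset.mem_Icc, Int.ceil_le, Int.le_floor]
    push_cast
    constructor <;> linarith [h1.1, h1.2]
  calc P (ValMap m ⁻¹' s ∩ E) ≤ P (⋃ j ∈ I, {x | x ∈ E ∧ (Jn x n : ℤ) = j}) := measure_mono hsub
    _ ≤ ∑ j ∈ I, P {x | x ∈ E ∧ (Jn x n : ℤ) = j} := measure_biUnion_finset_le _ _
    _ ≤ ∑ j ∈ I, c := by
      refine Finset.sum_le_sum fun j _ => ?_
      rcases Set.eq_empty_or_nonempty {x | x ∈ E ∧ (Jn x n : ℤ) = j} with h0 | ⟨y, hy, hyj⟩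
      · rw [h0]; simp
      · refine (measure_mono ?_).trans (hE y hy)
        rintro x ⟨_, hx⟩
        rw [← Jn_inj]
        have := hx.trans hyj.symm
        exact_mod_cast this
    _ = I.card * c := by rw [Finset.sum_const, nsmul_eq_mul]
    _ ≤ 4 * c := by gcongr; exact_mod_cast hI

lemma lower_dim (hm : 2 ≤ m) (P : Measure (ℕ+ → Fin m)) [IsProbabilityMeasure P] (t : NNReal)
    (ht : 0 < t) (h : ∀ᵐ x ∂P, ∀ᶠ n in atTop, P (CylN n x) ≤ rn m n ^ (t : ℝ))
    (F : Set ℝ) (hF : ∀ᵐ x ∂P, ValMap m x ∈ F) : (t : ℝ≥0∞) ≤ dimH F := by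
  have ht' : (0 : ℝ) < t := by exact_mod_cast ht
  let E : ℕ → Set (ℕ+ → Fin m) := fun N => {x | ∀ n ≥ N, P (CylN n x) ≤ rn m n ^ (t : ℝ)}
  obtain ⟨N, hN⟩ : ∃ N, P (E N) ≠ 0 := by
    by_contra! hcon
    have h1 : P (⋃ N, E N) = 0 := measure_iUnion_null hcon
    have h2 : ∀ᵐ x ∂P, x ∈ ⋃ N, E N := by
      filter_upwards [h] with x hx
      obtain ⟨N, hN⟩ := eventually_atTop.1 hx
      exact Set.mem_iUnion.2 ⟨N, hN⟩
    have h3 : ∀ᵐ x ∂P, x ∉ ⋃ N, E N := measure_eq_zero_iff_ae_notMem.1 h1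
    obtain ⟨x, hx, hx'⟩ := (h2.and h3).exists
    exact hx' hx
  let K : ℝ≥0∞ := 4 * (m : ℝ≥0∞) ^ (t : ℝ)
  have hK0 : K ≠ 0 := by
    refine mul_ne_zero (by norm_num) (ENNReal.rpow_pos ?_ (by simp)).ne'
    exact_mod_cast (by omega : 0 < m)
  have hKt : K ≠ ∞ := ENNReal.mul_ne_top (by norm_num) (ENNReal.rpow_ne_top_of_nonneg ht'.le (by simp))
  let lam : Measure ℝ := K⁻¹ • Measure.map (ValMap m) (P.restrict (E N))
  have hlam : lam ≤ Measure.hausdorffMeasure (t : ℝ) := by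
    refine Measure.le_hausdorffMeasure _ _ (rn m N) (rn_pos hm N) fun s hs => ?_
    have h1 : lam s ≤ K⁻¹ * P (ValMap m ⁻¹' (closure s) ∩ E N) := by
      refine (measure_mono subset_closure).trans ?_
      simp only [lam, Measure.smul_apply, smul_eq_mul]
      rw [Measure.map_apply measurable_val isClosed_closure.measurableSet,
        Measure.restrict_apply (measurable_val isClosed_closure.measurableSet)]
    refine h1.trans ?_
    rw [mul_comm, ← div_eq_mul_inv, ENNReal.div_le_iff hK0 hKt]
    have hd : Metric.ediam (closure s) = Metric.ediam s := Metric.ediam_closure s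
    have key : ∀ n ≥ N, Metric.ediam s ≤ rn m n →
        P (ValMap m ⁻¹' (closure s) ∩ E N) ≤ 4 * rn m n ^ (t : ℝ) := by
      intro n hn hsn
      exact lower_aux hm P _ n (E N) (fun x hx => hx n hn) _ (hd.le.trans hsn)
    by_cases h0 : Metric.ediam s = 0
    · have : Tendsto (fun n => 4 * rn m n ^ (t : ℝ)) atTop (𝓝 (4 * 0 ^ (t : ℝ))) :=
        ENNReal.Tendsto.const_mul (((ENNReal.continuous_rpow_const).tendsto _).comp (rn_tendsto hm))
          (Or.inr (by norm_num))
      rw [ENNReal.zero_rpow_of_pos ht', mul_zero] at this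
      have h2 := ge_of_tendsto this (by
        filter_upwards [eventually_ge_atTop N] with n hn
        exact key n hn (by rw [h0]; exact bot_le))
      exact h2.trans bot_le
    · have hex : ∃ n, rn m n < Metric.ediam s :=
        ((rn_tendsto hm).eventually (gt_mem_nhds (pos_iff_ne_zero.2 h0))).exists
      have hfind := Nat.find_spec hex
      have hgt : N < Nat.find hex := by
        by_contra! hc
        exact absurd (hs.trans (rn_anti hm hc)) (not_le.2 hfind)
      obtain ⟨n, hn⟩ : ∃ n, Nat.find hex = n + 1 := ⟨Nat.find hex - 1, by omega⟩
      have hmin := Nat.find_min hex (m := n) (by omega)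
      refine (key n (by omega) (not_lt.1 hmin)).trans ?_
      rw [hn] at hfind
      rw [rn_succ hm, ENNReal.mul_rpow_of_nonneg _ _ ht'.le, ← mul_assoc, mul_comm]
      gcongr
  refine le_dimH_of_hausdorffMeasure_ne_zero ?_
  have hpos : lam F ≠ 0 := by
    simp only [lam, Measure.smul_apply, smul_eq_mul]
    refine mul_ne_zero (ENNReal.inv_ne_zero.2 hKt) ?_
    refine ne_of_gt (lt_of_lt_of_le (pos_iff_ne_zero.2 hN) ?_)
    refine le_trans ?_ (Measure.le_map_apply measurable_val.aemeasurable F)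
    refine le_trans ?_ (Measure.le_restrict_apply _ _)
    refine measure_mono_ae ?_
    filter_upwards [hF] with x hx hxE
    exact ⟨hx, hxE⟩
  exact fun h0 => hpos (le_antisymm ((hlam F).trans h0.le) bot_le)

end PartB

section PartC

variable {m : ℕ}

/-- indices not divisible by `q`. -/
abbrev IdxQ (q : ℕ+) : Type := {i : ℕ+ // ¬ q ∣ i}

lemma dec_exists (q : ℕ+) (hq : 2 ≤ (q : ℕ)) (n : ℕ+) :
    ∃ p : ℕ × IdxQ q, n = q ^ p.1 * p.2.1 := by
  obtain ⟨e, n', h1, h2⟩ := Nat.exists_eq_pow_mul_and_not_dvd n.ne_zero (q : ℕ) (by omega)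
  have hn' : 0 < n' := by
    rcases Nat.eq_zero_or_pos n' with h | h
    · exact absurd (h ▸ dvd_zero _) h1
    · exact h
  refine ⟨(e, ⟨⟨n', hn'⟩, fun h => h1 (PNat.dvd_iff.1 h)⟩), PNat.eq ?_⟩
  rw [PNat.mul_coe, PNat.pow_coe]
  exact h2

lemma dec_unique (q : ℕ+) (a b : ℕ) (i j : IdxQ q) (h : q ^ a * i.1 = q ^ b * j.1) :
    a = b ∧ i = j := by
  have aux : ∀ (a b : ℕ) (i j : IdxQ q), q ^ a * i.1 = q ^ b * j.1 → b ≤ a := by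
    intro a b i j h
    by_contra! hlt
    obtain ⟨c, rfl⟩ : ∃ c, b = a + (c + 1) := ⟨b - a - 1, by omega⟩
    rw [pow_add, mul_assoc] at h
    have h' := mul_left_cancel h
    apply i.2
    rw [h', pow_succ', mul_assoc]
    exact Dvd.intro _ rfl
  have hab : a = b := le_antisymm (aux b a j i h.symm) (aux a b i j h)
  subst hab
  exact ⟨rfl, Subtype.ext (mul_left_cancel h)⟩

/-- the decomposition `n = q^ℓ i`. -/
def dec (q : ℕ+) (hq : 2 ≤ (q : ℕ)) (n : ℕ+) : ℕ × IdxQ q := (dec_exists q hq n).choose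

lemma dec_eq (q : ℕ+) (hq : 2 ≤ (q : ℕ)) (l : ℕ) (i : IdxQ q) : dec q hq (q ^ l * i.1) = (l, i) := by
  have h := (dec_exists q hq (q ^ l * i.1)).choose_spec
  have hu := dec_unique q _ _ _ _ h
  exact Prod.ext hu.1.symm hu.2.symm

/-- glue sequences along the geometric progressions. -/
def glue (q : ℕ+) (hq : 2 ≤ (q : ℕ)) (ω : IdxQ q → ℕ+ → Fin m) : ℕ+ → Fin m :=
  fun n => ω (dec q hq n).2 ⟨(dec q hq n).1 + 1, Nat.succ_pos _⟩

lemma glue_apply (q : ℕ+) (hq : 2 ≤ (q : ℕ)) (ω : IdxQ q → ℕ+ → Fin m) (l : ℕ) (i : IdxQ q) :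
    glue q hq ω (q ^ l * i.1) = ω i ⟨l + 1, Nat.succ_pos _⟩ := by
  simp [glue, dec_eq]

lemma measurable_glue (q : ℕ+) (hq : 2 ≤ (q : ℕ)) : Measurable (glue (m := m) q hq) := by
  unfold glue
  refine measurable_pi_lambda _ fun n => ?_
  exact (measurable_pi_apply _).comp (measurable_pi_apply _)

lemma restrJ_glue (q : ℕ+) (hq : 2 ≤ (q : ℕ)) (ω : IdxQ q → ℕ+ → Fin m) (i : IdxQ q) :
    RestrJ q (glue q hq ω) i.1 = ω i := by
  ext1 k
  rw [RestrJ, glue_apply]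
  congr 1
  apply PNat.eq
  have := k.pos
  simp; omega

lemma pow_mul_le_iff (q n i : ℕ+) (hq : 2 ≤ (q : ℕ)) (hin : i ≤ n) (l : ℕ) :
    q ^ l * i ≤ n ↔ l < Nat.log q (n / i : ℕ) + 1 := by
  have h0 : (n : ℕ) / i ≠ 0 := (Nat.div_pos (by exact_mod_cast hin) i.pos).ne'
  rw [Nat.lt_succ_iff, Nat.le_log_iff_pow_le (by omega) h0, Nat.le_div_iff_mul_le i.pos,
    ← PNat.coe_le_coe]
  simp

lemma cylJ_eq (q n i : ℕ+) (hq : 2 ≤ (q : ℕ)) (hin : i ≤ n) (x : ℕ+ → Fin m) :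
    CylJ q n i x = CylN (Nat.log q (n / i : ℕ) + 1) (RestrJ q x i) := by
  ext y
  simp only [CylJ, CylN, RestrJ, Set.mem_ofPred_eq]
  constructor
  · intro h k hk
    have hk0 := k.pos
    have := h ((k : ℕ) - 1) ((pow_mul_le_iff q n i hq hin _).2 (by omega))
    have hk' : (⟨(k : ℕ) - 1 + 1, Nat.succ_pos _⟩ : ℕ+) = k := by
      apply PNat.eq; simp; omega
    rwa [hk'] at this
  · intro h l hl
    have := h ⟨l + 1, Nat.succ_pos _⟩ ((pow_mul_le_iff q n i hq hin _).1 hl)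
    simpa using this

/-- indices `i ≤ n` with `q ∤ i`. -/
def Sn (q n : ℕ+) : Finset (IdxQ q) := (Finset.Icc 1 n).subtype (fun i => ¬ q ∣ i)

lemma mem_Sn (q n : ℕ+) (i : IdxQ q) : i ∈ Sn q n ↔ i.1 ≤ n := by
  simp [Sn]

lemma glue_preimage (q n : ℕ+) (hq : 2 ≤ (q : ℕ)) (x : ℕ+ → Fin m) :
    glue q hq ⁻¹' (CylN n x) = ((Sn q n : Finset (IdxQ q)) : Set (IdxQ q)).pi
      (fun i => CylJ q n i.1 x) := by
  ext ω
  simp only [Set.mem_preimage, CylN, CylJ, Set.mem_ofPred_eq, Set.mem_pi, SetLike.mem_coe, mem_Sn]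
  constructor
  · intro h i _ l hl
    exact (glue_apply q hq ω l i).symm.trans (h _ (by exact_mod_cast hl))
  · intro h k hk
    obtain ⟨⟨l, i⟩, rfl⟩ := dec_exists q hq k
    refine (glue_apply q hq ω l i).trans ?_
    have hk' : q ^ l * i.1 ≤ n := by exact_mod_cast hk
    refine h i ?_ l hk'
    refine le_trans ?_ hk'
    rw [← PNat.coe_le_coe, PNat.mul_coe]
    exact Nat.le_mul_of_pos_left _ (PNat.pos _)

lemma measure_eq_of_cylN (P P' : Measure (ℕ+ → Fin m)) [IsProbabilityMeasure P]
    [IsProbabilityMeasure P'] (h : ∀ (n : ℕ+) x, P (CylN n x) = P' (CylN n x)) : P = P' := by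
  have h1 : ∀ n : ℕ+, P.map (pre (n : ℕ)) = P'.map (pre (n : ℕ)) := by
    intro n
    refine Measure.ext_of_singleton fun w => ?_
    rw [Measure.map_apply (measurable_pre _) (MeasurableSet.singleton _),
      Measure.map_apply (measurable_pre _) (MeasurableSet.singleton _)]
    rcases Set.eq_empty_or_nonempty (pre (n : ℕ) ⁻¹' ({w} : Set (Fin n → Fin m))) with h0 | ⟨x, rfl⟩
    · rw [h0]; simp
    · rw [← cylN_eq, h]
  refine IsProjectiveLimit.unique (P := fun S : Finset ℕ+ => P.map S.restrict) (fun S => rfl) fun S => ?_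
  obtain ⟨n, hn⟩ : ∃ n : ℕ+, ∀ k ∈ S, k ≤ n := by
    obtain ⟨n, hn⟩ := S.bddAbove
    exact ⟨n, fun k hk => hn hk⟩
  let g : (Fin n → Fin m) → (S → Fin m) := fun w k => w ⟨(k : ℕ+) - 1, by
    have h1 := hn k.1 k.2
    have h2 := k.1.pos
    have h3 : (k.1 : ℕ) ≤ n := by exact_mod_cast h1
    omega⟩
  have hg : (S.restrict : (ℕ+ → Fin m) → (S → Fin m)) = g ∘ pre (n : ℕ) := by
    funext x k
    simp only [Function.comp, g, pre, Finset.restrict]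
    congr 1
    apply PNat.eq
    have h2 := k.1.pos
    simp; omega
  have hgm : Measurable g := by fun_prop
  show P'.map S.restrict = P.map S.restrict
  rw [hg, ← Measure.map_map hgm (measurable_pre _), ← Measure.map_map hgm (measurable_pre _), h1]

lemma map_glue (q : ℕ+) (hq : 2 ≤ (q : ℕ)) (μ P : Measure (ℕ+ → Fin m)) [IsProbabilityMeasure μ]
    [IsProbabilityMeasure P] (hP : ProdProp q μ P) :
    P = (Measure.infinitePi (fun _ : IdxQ q => μ)).map (glue q hq) := by
  have := Measure.isProbabilityMeasure_map (μ := Measure.infinitePi (fun _ : IdxQ q => μ))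
    (measurable_glue (m := m) q hq).aemeasurable
  refine measure_eq_of_cylN _ _ fun n x => ?_
  rw [Measure.map_apply (measurable_glue q hq) (measurableSet_cylN _ _), glue_preimage,
    Measure.infinitePi_pi, hP, Sn, Finset.prod_subtype_eq_prod_filter (fun i => μ (CylJ q n i x))]
  intro i hi
  rw [cylJ_eq q n i.1 hq ((mem_Sn q n i).1 hi)]
  exact measurableSet_cylN _ _

lemma ae_cyl_pos (μ : Measure (ℕ+ → Fin m)) : ∀ᵐ x ∂μ, ∀ n, μ (CylN n x) ≠ 0 := by
  rw [ae_all_iff]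
  intro n
  have h : ∀ᵐ x ∂μ, ∀ w : Fin n → Fin m, μ (pre n ⁻¹' {w}) = 0 → pre n x ≠ w := by
    rw [ae_all_iff]
    intro w
    by_cases hw : μ (pre n ⁻¹' {w}) = 0
    · filter_upwards [measure_eq_zero_iff_ae_notMem.1 hw] with x hx _ h
      exact hx h
    · exact Eventually.of_forall fun x h => absurd h hw
  filter_upwards [h] with x hx h0
  rw [cylN_eq] at h0
  exact hx _ h0 rfl

/-- information function. -/
def gk (m : ℕ) (μ : Measure (ℕ+ → Fin m)) (k : ℕ) (y : ℕ+ → Fin m) : ℝ :=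
  -Real.logb m (μ (CylN k y)).toReal

lemma gk_eq (μ : Measure (ℕ+ → Fin m)) (k : ℕ) :
    gk m μ k = (fun w : Fin k → Fin m => -Real.logb m (μ (pre k ⁻¹' {w})).toReal) ∘ pre k := by
  funext y; simp [gk, cylN_eq]

lemma measurable_gk (μ : Measure (ℕ+ → Fin m)) (k : ℕ) : Measurable (gk m μ k) := by
  rw [gk_eq]; exact (measurable_of_finite _).comp (measurable_pre k)

lemma memLp_gk (μ : Measure (ℕ+ → Fin m)) [IsProbabilityMeasure μ] (k : ℕ) (p : ℝ≥0∞) :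
    MemLp (gk m μ k) p μ := by
  refine MemLp.of_bound (measurable_gk μ k).aestronglyMeasurable
    (∑ w : Fin k → Fin m, |-Real.logb m (μ (pre k ⁻¹' {w})).toReal|) (Eventually.of_forall fun y => ?_)
  rw [gk_eq]
  exact Finset.single_le_sum (f := fun w : Fin k → Fin m => |-Real.logb m (μ (pre k ⁻¹' {w})).toReal|)
    (fun w _ => abs_nonneg _) (Finset.mem_univ (pre k y))

lemma integral_pre (μ : Measure (ℕ+ → Fin m)) [IsProbabilityMeasure μ] (k : ℕ)
    (f : (Fin k → Fin m) → ℝ) :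
    ∫ y, f (pre k y) ∂μ = ∑ w, (μ (pre k ⁻¹' {w})).toReal * f w := by
  have := Measure.isProbabilityMeasure_map (μ := μ) (measurable_pre k).aemeasurable
  rw [← integral_map (measurable_pre k).aemeasurable (measurable_of_finite f).aestronglyMeasurable,
    integral_fintype (Integrable.of_finite)]
  refine Finset.sum_congr rfl fun w _ => ?_
  rw [smul_eq_mul, Measure.real, Measure.map_apply (measurable_pre _) (MeasurableSet.singleton _)]

lemma integral_gk (μ : Measure (ℕ+ → Fin m)) [IsProbabilityMeasure μ] (k : ℕ) :
    ∫ y, gk m μ k y ∂μ = Hent m μ k := by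
  rw [gk_eq]
  simp only [Function.comp]
  rw [integral_pre μ k (fun w => -Real.logb m (μ (pre k ⁻¹' {w})).toReal), Hent, ← Finset.sum_neg_distrib]
  simp only [cyl_ofFn, mul_neg]

lemma plogp_bound (hm : 2 ≤ m) (k : ℕ) (p : ℝ) (hp0 : 0 ≤ p) (hp1 : p ≤ 1) :
    p * (Real.logb m p) ^ 2 ≤ 4 * (k : ℝ) ^ 2 * p + 16 / (Real.log m) ^ 2 * ((m : ℝ) ^ k)⁻¹ := by
  have hm1 : (1 : ℝ) < m := by exact_mod_cast (by omega : 1 < m)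
  have hL : 0 < Real.log m := Real.log_pos hm1
  have hmk : (0 : ℝ) < ((m : ℝ) ^ k)⁻¹ := by positivity
  rcases hp0.eq_or_lt with h0 | h0
  · rw [← h0]; simp; positivity
  by_cases hp : (((m : ℝ) ^ k)⁻¹) ^ 2 ≤ p
  · have h1 : -(2 * (k : ℝ)) ≤ Real.logb m p := by
      rw [Real.le_logb_iff_rpow_le hm1 h0]
      refine le_trans (le_of_eq ?_) hp
      rw [Real.rpow_neg (by positivity), mul_comm, Real.rpow_mul (by positivity), Real.rpow_natCast,
        inv_pow]
      norm_cast
    have h2 : Real.logb m p ≤ 0 := Real.logb_nonpos hm1 hp0 hp1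
    have h3 : (Real.logb m p) ^ 2 ≤ 4 * (k : ℝ) ^ 2 := by nlinarith
    have : 0 ≤ 16 / (Real.log m) ^ 2 * ((m : ℝ) ^ k)⁻¹ := by positivity
    nlinarith [mul_le_mul_of_nonneg_left h3 hp0]
  · push Not at hp
    set s := p ^ ((1 : ℝ) / 4) with hs
    have hs0 : 0 < s := by positivity
    have hs4 : s ^ 4 = p := by
      rw [hs, ← Real.rpow_natCast, ← Real.rpow_mul hp0]; norm_num
    have h1 := Real.abs_log_mul_self_rpow_lt p (1 / 4) h0 hp1 (by norm_num)
    rw [← hs] at h1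
    norm_num at h1
    have h2 : (Real.log p * s) ^ 2 ≤ 16 := by
      rw [abs_of_pos hs0] at h1
      have h5 : -4 < Real.log p * s ∧ Real.log p * s < 4 := by
        rw [← abs_lt, abs_mul, abs_of_pos hs0]; exact h1
      nlinarith [h5.1, h5.2]
    have h3 : s ^ 2 ≤ ((m : ℝ) ^ k)⁻¹ := by
      refine le_of_sq_le_sq ?_ hmk.le
      rw [← pow_mul, hs4]; exact hp.le
    have h4 : p * (Real.logb m p) ^ 2 = (Real.log p * s) ^ 2 * s ^ 2 / (Real.log m) ^ 2 := by
      rw [Real.logb, ← hs4]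
      rw [hs4]
      rw [div_pow, mul_pow]
      nth_rewrite 1 [← hs4]
      ring
    rw [h4]
    have h6 : (Real.log p * s) ^ 2 * s ^ 2 ≤ 16 * ((m : ℝ) ^ k)⁻¹ :=
      mul_le_mul h2 h3 (by positivity) (by norm_num)
    have h7 : (Real.log p * s) ^ 2 * s ^ 2 / (Real.log m) ^ 2 ≤ 16 * ((m : ℝ) ^ k)⁻¹ / (Real.log m) ^ 2 :=
      div_le_div_of_nonneg_right h6 (by positivity)
    have : 0 ≤ 4 * (k : ℝ) ^ 2 * p := by positivity
    calc _ ≤ _ := h7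
      _ = 16 / (Real.log m) ^ 2 * ((m : ℝ) ^ k)⁻¹ := by ring
      _ ≤ _ := by linarith

lemma second_moment (hm : 2 ≤ m) (μ : Measure (ℕ+ → Fin m)) [IsProbabilityMeasure μ] (k : ℕ) :
    ∫ y, (gk m μ k y) ^ 2 ∂μ ≤ 4 * (k : ℝ) ^ 2 + 16 / (Real.log m) ^ 2 := by
  have h := integral_pre μ k (fun w => (-Real.logb m (μ (pre k ⁻¹' {w})).toReal) ^ 2)
  have hg : ∀ y, gk m μ k y = -Real.logb m (μ (pre k ⁻¹' {pre k y})).toReal := fun y => by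
    simp [gk, cylN_eq]
  simp only [hg]
  have h1 := integral_pre μ k (fun _ => (1 : ℝ))
  simp only [integral_const, probReal_univ, smul_eq_mul, mul_one] at h1
  rw [h]
  calc ∑ w : Fin k → Fin m, (μ (pre k ⁻¹' {w})).toReal * (-Real.logb m (μ (pre k ⁻¹' {w})).toReal) ^ 2
      ≤ ∑ w : Fin k → Fin m, (4 * (k : ℝ) ^ 2 * (μ (pre k ⁻¹' {w})).toReal +
          16 / (Real.log m) ^ 2 * ((m : ℝ) ^ k)⁻¹) := by
        refine Finset.sum_le_sum fun w _ => ?_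
        rw [neg_sq]
        exact plogp_bound hm k _ ENNReal.toReal_nonneg measureReal_le_one
    _ = _ := by
        rw [Finset.sum_add_distrib, ← Finset.mul_sum, ← h1, Finset.sum_const, Finset.card_univ]
        simp only [Fintype.card_fun, Fintype.card_fin, nsmul_eq_mul]
        have : ((m : ℝ) ^ k) ≠ 0 := by positivity
        push_cast
        field_simp

end PartC

section PartD

open ProbabilityTheory

variable {m : ℕ}

lemma sum_Sn (q n : ℕ+) (a : ℕ → ℝ) :
    ∑ i ∈ Sn q n, a (Nat.log q (n / i.1 : ℕ) + 1) =
      ∑ i ∈ (Finset.Ioc 0 (n : ℕ)).filter (fun i => ¬ (q : ℕ) ∣ i), a (Nat.log q (n / i : ℕ) + 1) := by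
  refine Finset.sum_bij (fun i _ => ((i.1 : ℕ+) : ℕ)) ?_ ?_ ?_ ?_
  · intro i hi
    rw [Finset.mem_filter, Finset.mem_Ioc]
    exact ⟨⟨i.1.pos, by exact_mod_cast (mem_Sn q n i).1 hi⟩, fun h => i.2 (PNat.dvd_iff.2 h)⟩
  · intro i _ j _ h
    exact Subtype.ext (PNat.eq h)
  · intro b hb
    rw [Finset.mem_filter, Finset.mem_Ioc] at hb
    refine ⟨⟨⟨b, hb.1.1⟩, fun h => hb.2 (PNat.dvd_iff.1 h)⟩, ?_, rfl⟩
    rw [mem_Sn, ← PNat.coe_le_coe]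
    exact hb.1.2
  · intro i _
    rfl

/-- the sum of information functions over the progressions. -/
def Tsum (m : ℕ) (q : ℕ+) (μ : Measure (ℕ+ → Fin m)) (n : ℕ+) : (IdxQ q → ℕ+ → Fin m) → ℝ :=
  ∑ i ∈ Sn q n, fun ω => gk m μ (Nat.log q (n / i.1 : ℕ) + 1) (ω i)

lemma logP_eq (q : ℕ+) (hq : 2 ≤ (q : ℕ)) (μ P : Measure (ℕ+ → Fin m)) [IsProbabilityMeasure μ]
    [IsProbabilityMeasure P] (hP : ProdProp q μ P) :
    ∀ᵐ ω ∂(Measure.infinitePi (fun _ : IdxQ q => μ)), ∀ n : ℕ+,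
      -Real.logb m (P (CylN n (glue q hq ω))).toReal = Tsum m q μ n ω := by
  have h : ∀ᵐ ω ∂(Measure.infinitePi (fun _ : IdxQ q => μ)), ∀ i : IdxQ q, ∀ k, μ (CylN k (ω i)) ≠ 0 := by
    rw [ae_all_iff]
    intro i
    exact (measurePreserving_eval_infinitePi (fun _ : IdxQ q => μ) i).quasiMeasurePreserving.ae
      (ae_cyl_pos μ)
  filter_upwards [h] with ω hω n
  rw [hP, ← Finset.prod_subtype_eq_prod_filter (fun i => μ (CylJ q n i (glue q hq ω))), Tsum,
    Finset.sum_apply]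
  have h1 : ∀ i ∈ Sn q n, μ (CylJ q n i.1 (glue q hq ω)) =
      μ (CylN (Nat.log q (n / i.1 : ℕ) + 1) (ω i)) := by
    intro i hi
    rw [cylJ_eq q n i.1 hq ((mem_Sn q n i).1 hi), restrJ_glue]
  have h2 := Finset.prod_congr rfl h1
  rw [Sn] at h2
  rw [h2, ENNReal.toReal_prod, Real.logb_prod, ← Finset.sum_neg_distrib]
  · rfl
  · intro i _
    exact ENNReal.toReal_ne_zero.2 ⟨hω i _, measure_ne_top _ _⟩

section moments

variable (q : ℕ+) (μ : Measure (ℕ+ → Fin m)) [IsProbabilityMeasure μ]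

lemma memLp_term (i : IdxQ q) (k : ℕ) :
    MemLp (fun ω : IdxQ q → ℕ+ → Fin m => gk m μ k (ω i)) 2 (Measure.infinitePi (fun _ : IdxQ q => μ)) :=
  (memLp_gk μ k 2).comp_measurePreserving (measurePreserving_eval_infinitePi (fun _ : IdxQ q => μ) i)

lemma integral_eval (i : IdxQ q) (f : (ℕ+ → Fin m) → ℝ) (hf : Measurable f) :
    ∫ ω, f (ω i) ∂(Measure.infinitePi (fun _ : IdxQ q => μ)) = ∫ y, f y ∂μ := by
  have h := (measurePreserving_eval_infinitePi (fun _ : IdxQ q => μ) i).map_eq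
  rw [← integral_map (φ := Function.eval i) (measurable_pi_apply i).aemeasurable
    hf.aestronglyMeasurable, h]

lemma memLp_Tsum (n : ℕ+) : MemLp (Tsum m q μ n) 2 (Measure.infinitePi (fun _ : IdxQ q => μ)) :=
  memLp_finsetSum' _ fun i _ => memLp_term q μ i _

lemma integral_Tsum (n : ℕ+) :
    ∫ ω, Tsum m q μ n ω ∂(Measure.infinitePi (fun _ : IdxQ q => μ)) =
      ∑ i ∈ Sn q n, Hent m μ (Nat.log q (n / i.1 : ℕ) + 1) := by
  simp only [Tsum, Finset.sum_apply]
  rw [integral_finsetSum _ fun i _ => (memLp_term q μ i _).integrable (by norm_num)]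
  refine Finset.sum_congr rfl fun i _ => ?_
  rw [integral_eval q μ i _ (measurable_gk μ _), integral_gk]

lemma var_Tsum (hm : 2 ≤ m) (n : ℕ+) :
    Var[Tsum m q μ n; Measure.infinitePi (fun _ : IdxQ q => μ)] ≤
      ∑ i ∈ Sn q n, (4 * ((Nat.log q (n / i.1 : ℕ) + 1 : ℕ) : ℝ) ^ 2 + 16 / (Real.log m) ^ 2) := by
  rw [Tsum, IndepFun.variance_sum (fun i _ => memLp_term q μ i _)]
  · refine Finset.sum_le_sum fun i _ => ?_
    refine (variance_le_expectation_sq (memLp_term q μ i _).aestronglyMeasurable).trans ?_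
    refine le_trans (le_of_eq ?_) (second_moment hm μ _)
    exact integral_eval q μ i (fun y => gk m μ (Nat.log q (n / i.1 : ℕ) + 1) y ^ 2)
      ((measurable_gk μ _).pow_const 2)
  · intro i _ j _ hij
    exact (iIndepFun_infinitePi (P := fun _ : IdxQ q => μ)
      (X := fun i : IdxQ q => gk m μ (Nat.log q (n / i.1 : ℕ) + 1))
      (fun i => measurable_gk μ _)).indepFun hij

lemma Hent_bound (hm : 2 ≤ m) (k : ℕ) :
    |Hent m μ (k + 1)| ≤ (5 + 16 / (Real.log m) ^ 2) * ((k : ℝ) + 1) ^ 2 := by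
  have hC : 0 ≤ 16 / (Real.log m) ^ 2 := by positivity
  have h2 := second_moment hm μ (k + 1)
  have hi2 := (memLp_gk (m := m) μ (k + 1) 2).integrable_sq
  have h1 : |Hent m μ (k + 1)| ≤ ∫ y, (1 + gk m μ (k + 1) y ^ 2) ∂μ := by
    rw [← integral_gk]
    refine (abs_integral_le_integral_abs).trans ?_
    refine integral_mono ((memLp_gk μ (k + 1) 2).integrable (by norm_num)).abs
      ((integrable_const _).add hi2) fun y => ?_
    show |gk m μ (k + 1) y| ≤ 1 + gk m μ (k + 1) y ^ 2
    rw [← sq_abs]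
    nlinarith [sq_nonneg (|gk m μ (k + 1) y| - 1), sq_nonneg (|gk m μ (k + 1) y|)]
  rw [integral_add (integrable_const _) hi2] at h1
  simp only [integral_const, probReal_univ, smul_eq_mul, mul_one] at h1
  push_cast at h2
  have hk : (1 : ℝ) ≤ ((k : ℝ) + 1) ^ 2 := by
    have : (0 : ℝ) ≤ k := by positivity
    nlinarith
  nlinarith [mul_le_mul_of_nonneg_left hk hC]

end moments

/-- the positive integer `(j+1)^2`. -/
def sqP (j : ℕ) : ℕ+ := ⟨(j + 1) ^ 2, by positivity⟩

lemma tendsto_sqP : Tendsto (fun j => ((sqP j : ℕ+) : ℕ)) atTop atTop := by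
  refine tendsto_atTop_mono (fun j => ?_) tendsto_id
  show j ≤ (j + 1) ^ 2
  nlinarith

lemma ae_subseq (q : ℕ+) (hq : 2 ≤ (q : ℕ)) (hm : 2 ≤ m) (μ : Measure (ℕ+ → Fin m))
    [IsProbabilityMeasure μ] :
    ∀ᵐ ω ∂(Measure.infinitePi (fun _ : IdxQ q => μ)),
      Tendsto (fun j => Tsum m q μ (sqP j) ω / ((sqP j : ℕ+) : ℕ)) atTop (𝓝 (sOm m q μ)) := by
  set Q := Measure.infinitePi (fun _ : IdxQ q => μ) with hQ
  have hC : 0 ≤ 16 / (Real.log m) ^ 2 := by positivity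
  have hmean := (det_limit q hq (Hent m μ) _ (Hent_bound μ hm)).comp tendsto_sqP
  have hmean' : Tendsto (fun j => (∫ ω, Tsum m q μ (sqP j) ω ∂Q) / ((sqP j : ℕ+) : ℕ)) atTop
      (𝓝 (sOm m q μ)) := by
    refine hmean.congr fun j => ?_
    rw [integral_Tsum, sum_Sn]
    rfl
  obtain ⟨M, hM⟩ := (det_limit q hq (fun k => 4 * (k : ℝ) ^ 2 + 16 / (Real.log m) ^ 2)
    (4 + 16 / (Real.log m) ^ 2) (fun k => by
      rw [abs_of_nonneg (by positivity)]
      push_cast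
      have hk : (1 : ℝ) ≤ ((k : ℝ) + 1) ^ 2 := by
        have : (0 : ℝ) ≤ k := by positivity
        nlinarith
      nlinarith [mul_le_mul_of_nonneg_left hk hC])).bddAbove_range
  have hvar : ∀ n : ℕ+, Var[Tsum m q μ n; Q] ≤ M * n := by
    intro n
    refine (var_Tsum q μ hm n).trans ?_
    rw [sum_Sn q n (fun k => 4 * (k : ℝ) ^ 2 + 16 / (Real.log m) ^ 2)]
    have := hM ⟨(n : ℕ), rfl⟩
    rwa [div_le_iff₀ (by exact_mod_cast n.pos)] at this
  have hint : ∀ j, ∫⁻ ω, ENNReal.ofReal (((Tsum m q μ (sqP j) ω - ∫ ω, Tsum m q μ (sqP j) ω ∂Q) /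
      ((sqP j : ℕ+) : ℕ)) ^ 2) ∂Q ≤ ENNReal.ofReal (M * (1 / ((j : ℝ) + 1) ^ 2)) := by
    intro j
    have hn : (0 : ℝ) < ((sqP j : ℕ+) : ℕ) := by exact_mod_cast (sqP j).pos
    have h1 : ∀ ω, ENNReal.ofReal (((Tsum m q μ (sqP j) ω - ∫ ω, Tsum m q μ (sqP j) ω ∂Q) /
      ((sqP j : ℕ+) : ℕ)) ^ 2) = ENNReal.ofReal ((((sqP j : ℕ+) : ℕ) : ℝ) ^ 2)⁻¹ *
        ENNReal.ofReal ((Tsum m q μ (sqP j) ω - ∫ ω, Tsum m q μ (sqP j) ω ∂Q) ^ 2) := by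
      intro ω
      rw [← ENNReal.ofReal_mul (by positivity)]
      congr 1
      rw [div_pow]; ring
    simp only [h1]
    rw [lintegral_const_mul' _ _ ENNReal.ofReal_ne_top, ← evariance_eq_lintegral_ofReal,
      ← ofReal_variance (memLp_Tsum q μ _), ← ENNReal.ofReal_mul (by positivity)]
    apply ENNReal.ofReal_le_ofReal
    calc ((((sqP j : ℕ+) : ℕ) : ℝ) ^ 2)⁻¹ * Var[Tsum m q μ (sqP j); Q]
        ≤ ((((sqP j : ℕ+) : ℕ) : ℝ) ^ 2)⁻¹ * (M * (((sqP j : ℕ+) : ℕ) : ℝ)) := by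
          gcongr; exact hvar _
      _ = M * (1 / (((sqP j : ℕ+) : ℕ) : ℝ)) := by field_simp
      _ = _ := by simp [sqP]
  have hsum : ∑' j : ℕ, ENNReal.ofReal (M * (1 / ((j : ℝ) + 1) ^ 2)) ≠ ∞ := by
    refine Summable.tsum_ofReal_ne_top ?_
    refine Summable.mul_left _ ?_
    have := (summable_nat_add_iff 1).2 (Real.summable_one_div_nat_pow.2 (by norm_num : 1 < 2))
    refine this.congr fun j => by push_cast; rfl
  have hae : ∀ᵐ ω ∂Q, ∑' j, ENNReal.ofReal (((Tsum m q μ (sqP j) ω - ∫ ω, Tsum m q μ (sqP j) ω ∂Q) /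
      ((sqP j : ℕ+) : ℕ)) ^ 2) < ∞ := by
    have hmeas : ∀ j, AEMeasurable (fun ω => ENNReal.ofReal (((Tsum m q μ (sqP j) ω -
        ∫ ω, Tsum m q μ (sqP j) ω ∂Q) / ((sqP j : ℕ+) : ℕ)) ^ 2)) Q := fun j =>
      ((((memLp_Tsum q μ _).aestronglyMeasurable.aemeasurable.sub_const _).div_const _).pow_const 2).ennreal_ofReal
    refine ae_lt_top' (AEMeasurable.tsum hmeas) ?_
    rw [lintegral_tsum hmeas]
    exact ne_top_of_le_ne_top hsum (ENNReal.tsum_le_tsum hint)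
  filter_upwards [hae] with ω hω
  have h0 := ENNReal.tendsto_atTop_zero_of_tsum_ne_top hω.ne
  have h1 := (ENNReal.tendsto_toReal ENNReal.zero_ne_top).comp h0
  have h2 : Tendsto (fun j => |(Tsum m q μ (sqP j) ω - ∫ ω, Tsum m q μ (sqP j) ω ∂Q) /
      ((sqP j : ℕ+) : ℕ)|) atTop (𝓝 0) := by
    have h3 := (Real.continuous_sqrt.tendsto _).comp h1
    simp only [ENNReal.toReal_zero, Real.sqrt_zero] at h3
    refine h3.congr fun j => ?_
    simp only [Function.comp]
    rw [ENNReal.toReal_ofReal (by positivity), Real.sqrt_sq_eq_abs]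
  have h4 := ((tendsto_zero_iff_abs_tendsto_zero _).2 h2).add hmean'
  rw [zero_add] at h4
  refine h4.congr fun j => ?_
  ring

lemma ae_limit (q : ℕ+) (hq : 2 ≤ (q : ℕ)) (hm : 2 ≤ m) (μ P : Measure (ℕ+ → Fin m))
    [IsProbabilityMeasure μ] [IsProbabilityMeasure P] (hP : ProdProp q μ P) :
    ∀ᵐ x ∂P, Tendsto (fun n : ℕ => -Real.logb m ((P (CylN n x)).toReal) / n) atTop
        (𝓝 (sOm m q μ)) := by
  have hm1 : (1 : ℝ) < m := by exact_mod_cast (by omega : 1 < m)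
  have hsub : ∀ᵐ x ∂P, Tendsto (fun j => -Real.logb m ((P (CylN ((sqP j : ℕ+) : ℕ) x)).toReal) /
      ((sqP j : ℕ+) : ℕ)) atTop (𝓝 (sOm m q μ)) := by
    have hmp : MeasurePreserving (glue (m := m) q hq) (Measure.infinitePi (fun _ : IdxQ q => μ)) P :=
      ⟨measurable_glue q hq, (map_glue q hq μ P hP).symm⟩
    have hmeas : ∀ n : ℕ, Measurable fun x => -Real.logb m ((P (CylN n x)).toReal) := fun n =>
      measurable_gk P n
    rw [hmp.map_eq.symm, ae_map_iff (measurable_glue q hq).aemeasurable, hmp.map_eq]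
    · filter_upwards [logP_eq q hq μ P hP, ae_subseq q hq hm μ] with ω h1 h2
      refine h2.congr fun j => ?_
      rw [h1]
    · exact measurableSet_tendsto _ fun j => (measurable_gk _ _).div_const _
  filter_upwards [hsub, ae_cyl_pos P] with x hx hpos
  refine tendsto_div_of_monotone_of_exists_subseq_tendsto_div
    (fun n => -Real.logb m ((P (CylN n x)).toReal)) _ ?_ ?_
  · intro a b hab
    refine neg_le_neg ?_
    refine Real.logb_le_logb_of_le hm1 (ENNReal.toReal_pos (hpos b) (measure_ne_top _ _)) ?_
    exact ENNReal.toReal_mono (measure_ne_top _ _) (measure_mono (cylN_anti x hab))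
  · intro a ha
    refine ⟨fun j => ((sqP j : ℕ+) : ℕ), ?_, tendsto_sqP, hx⟩
    have h1 : Tendsto (fun j : ℕ => (1 + 1 / ((j : ℝ) + 1)) ^ 2) atTop (𝓝 ((1 + 0) ^ 2)) :=
      ((tendsto_one_div_add_atTop_nhds_zero_nat (𝕜 := ℝ)).const_add 1).pow 2
    filter_upwards [h1.eventually (gt_mem_nhds (show ((1 : ℝ) + 0) ^ 2 < a by simpa using ha))] with j hj
    simp only [sqP, PNat.mk_coe]
    push_cast
    have hj0 : (0 : ℝ) < (j : ℝ) + 1 := by positivity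
    calc ((j : ℝ) + 1 + 1) ^ 2 = (1 + 1 / ((j : ℝ) + 1)) ^ 2 * ((j : ℝ) + 1) ^ 2 := by field_simp
      _ ≤ _ := by gcongr

lemma rn_rpow (hm : 2 ≤ m) (n : ℕ) (t : ℝ) (ht : 0 ≤ t) :
    rn m n ^ t = ENNReal.ofReal ((m : ℝ) ^ (-(t * n))) := by
  rw [rn, ENNReal.ofReal_rpow_of_nonneg (by positivity) ht]
  congr 1
  rw [Real.inv_rpow (by positivity), ← Real.rpow_natCast, ← Real.rpow_mul (by positivity),
    Real.rpow_neg (by positivity), mul_comm]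

end PartD

/-- **Proposition 2.3.** The pointwise dimension of `P_μ` is `P_μ`-a.e. equal to `s(Ω,μ)`;
hence `dim_H(P_μ) = s(Ω,μ)` and `dim_H(Ξ_Ω) ≥ s(Ω,μ)`. -/
theorem stmt11 (m : ℕ) (hm : 2 ≤ m) (q : ℕ+) (hq : 2 ≤ (q : ℕ))
    (Ω : Set (ℕ+ → Fin m)) (hne : Ω.Nonempty) (hcl : IsClosed Ω)
    (μ : Measure (ℕ+ → Fin m)) [IsProbabilityMeasure μ] (hμΩ : μ Ω = 1)
    (P : Measure (ℕ+ → Fin m)) [IsProbabilityMeasure P] (hP : ProdProp q μ P) :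
    (∀ᵐ x ∂P,
      Tendsto (fun n : ℕ => -Real.logb m ((P (CylN n x)).toReal) / n) atTop
        (𝓝 (sOm m q μ))) ∧
    sInf {d : ℝ≥0∞ | ∃ F : Set ℝ, MeasurableSet F ∧
        Measure.map (ValMap m) P F = 1 ∧ d = dimH F} =
      ENNReal.ofReal (sOm m q μ) ∧
    ENNReal.ofReal (sOm m q μ) ≤ dimH (XiSet (XOm q Ω)) := by
  have hm1 : (1 : ℝ) < m := by exact_mod_cast (by omega : 1 < m)
  have hlim := ae_limit q hq hm μ P hP
  have hlow : ∀ F : Set ℝ, (∀ᵐ x ∂P, ValMap m x ∈ F) → ENNReal.ofReal (sOm m q μ) ≤ dimH F := by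
    intro F hF
    refine le_of_forall_lt fun c hc => ?_
    obtain ⟨t, hct, hts⟩ := ENNReal.lt_iff_exists_nnreal_btwn.1 hc
    have ht0 : 0 < t := by
      have h0 : (0 : ℝ≥0∞) < t := lt_of_le_of_lt (zero_le) hct
      exact_mod_cast h0
    have hts' : (t : ℝ) < sOm m q μ := by
      rw [← ENNReal.ofReal_coe_nnreal] at hts
      exact lt_of_not_ge fun h => absurd hts (not_lt.2 (ENNReal.ofReal_le_ofReal h))
    refine hct.trans_le (lower_dim hm P t ht0 ?_ F hF)
    filter_upwards [hlim, ae_cyl_pos P] with x hx hpos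
    filter_upwards [hx.eventually (lt_mem_nhds hts'), eventually_gt_atTop 0] with n hn hn0
    rw [rn_rpow hm n t t.2, ← ENNReal.ofReal_toReal (measure_ne_top P (CylN n x))]
    apply ENNReal.ofReal_le_ofReal
    have hp : 0 < (P (CylN n x)).toReal := ENNReal.toReal_pos (hpos n) (measure_ne_top _ _)
    rw [lt_div_iff₀ (by exact_mod_cast hn0)] at hn
    rw [← Real.logb_le_iff_le_rpow hm1 hp]
    linarith
  refine ⟨hlim, le_antisymm ?_ ?_, ?_⟩
  · refine le_of_forall_gt fun c hc => ?_
    obtain ⟨t, hst, htc⟩ := ENNReal.lt_iff_exists_nnreal_btwn.1 hc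
    have ht0 : 0 < t := by
      have h0 : (0 : ℝ≥0∞) < t := lt_of_le_of_lt (zero_le) hst
      exact_mod_cast h0
    have hst' : sOm m q μ < t := by
      rw [← ENNReal.ofReal_coe_nnreal] at hst
      exact (ENNReal.ofReal_lt_ofReal_iff (by exact_mod_cast ht0)).1 hst
    obtain ⟨F, hF1, hF2, hF3⟩ := upper_dim hm P t ht0 (by
      filter_upwards [hlim, ae_cyl_pos P] with x hx hpos
      filter_upwards [hx.eventually (gt_mem_nhds hst'), eventually_gt_atTop 0] with n hn hn0
      rw [rn_rpow hm n t t.2, ← ENNReal.ofReal_toReal (measure_ne_top P (CylN n x))]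
      apply ENNReal.ofReal_le_ofReal
      have hp : 0 < (P (CylN n x)).toReal := ENNReal.toReal_pos (hpos n) (measure_ne_top _ _)
      rw [div_lt_iff₀ (by exact_mod_cast hn0)] at hn
      rw [← Real.le_logb_iff_rpow_le hm1 hp]
      linarith)
    refine lt_of_le_of_lt (sInf_le (a := dimH F) ?_) (hF3.trans_lt htc)
    exact ⟨F, hF1, hF2, rfl⟩
  · refine le_sInf ?_
    rintro d ⟨F, hF1, hF2, rfl⟩
    refine hlow F ?_
    rw [Measure.map_apply measurable_val hF1] at hF2
    exact (mem_ae_iff_prob_eq_one (measurable_val hF1)).2 hF2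
  · refine hlow _ ?_
    have hΩ : ∀ᵐ y ∂μ, y ∈ Ω := (mem_ae_iff_prob_eq_one hcl.measurableSet).2 hμΩ
    have hX : ∀ᵐ x ∂P, x ∈ XOm q Ω := by
      have hcount : ∀ i : IdxQ q, ∀ᵐ x ∂P, RestrJ q x i.1 ∈ Ω := by
        intro i
        have hr : Measurable (fun x : ℕ+ → Fin m => RestrJ q x i.1) :=
          measurable_pi_lambda _ fun k => measurable_pi_apply _
        rw [map_glue q hq μ P hP, ae_map_iff (measurable_glue q hq).aemeasurable
          (hr hcl.measurableSet)]
        filter_upwards [(measurePreserving_eval_infinitePi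
          (fun _ : IdxQ q => μ) i).quasiMeasurePreserving.ae hΩ] with ω hω
        rw [restrJ_glue]
        exact hω
      filter_upwards [ae_all_iff.2 hcount] with x hx i hi
      exact hx ⟨i, hi⟩
    filter_upwards [hX] with x hx
    exact ⟨x, hx, rfl⟩
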